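/- Let K_p, K_q : ℤ → ℝ be even, absolutely summable functions whose spectra S_p(f) = Σ_{m∈ℤ} K_p(m) e^{−2πi f m} and S_q(f) = Σ_{m∈ℤ} K_q(m) e^{−2πi f m} satisfy 0 < c ≤ S_p(f), S_q(f) ≤ M for all f ∈ [0,1]. For each n let p^{(n)} = N(0, Λ_p^{(n)}) and q^{(n)} = N(0, Λ_q^{(n)}) be the centered Gaussian measures on ℝⁿ with Toeplitz covariance matrices Λ_p^{(n)}_{ij} = K_p(i−j), Λ_q^{(n)}_{ij} = K_q(i−j). Fix 0 < τ < 1/2 and set β_{τ,n} = inf{ q^{(n)}(B) : B ⊆ ℝⁿ measurable, p^{(n)}(Bᶜ) < τ }. Then (−ln β_{τ,n})/n → C_s as n → ∞, where C_s = (1/2) ∫₀¹ ( S_p(f)/S_q(f) − ln( S_p(f)/S_q(f) ) − 1 ) df; that is, −ln β_{τ,n} = C_s·n + o(n). -/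

import Mathlib

open MeasureTheory Filter Matrix

/-- The spectrum `S(f) = Σ_{m ∈ ℤ} K(m) e^{-2πi f m}` of an even, absolutely summable
auto-covariance function `K : ℤ → ℝ`; by evenness it equals the real cosine series. -/
noncomputable def spectrum' (K : ℤ → ℝ) (f : ℝ) : ℝ :=
  ∑' m : ℤ, K m * Real.cos (2 * Real.pi * f * (m : ℝ))

/-- The `n × n` symmetric Toeplitz matrix with entries `K(i - j)`. -/
def toeplitz (K : ℤ → ℝ) (n : ℕ) : Matrix (Fin n) (Fin n) ℝ :=
  fun i j => K ((i : ℤ) - (j : ℤ))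

/-- The density of the centered multivariate Gaussian `N(0, Λ)` on `ℝⁿ`. -/
noncomputable def gaussianPdf (n : ℕ) (Λ : Matrix (Fin n) (Fin n) ℝ) (x : Fin n → ℝ) : ℝ :=
  (Real.sqrt ((2 * Real.pi) ^ n * Λ.det))⁻¹ * Real.exp (-(x ⬝ᵥ (Λ⁻¹ *ᵥ x)) / 2)

/-- The centered multivariate Gaussian measure `N(0, Λ)` on `ℝⁿ`. -/
noncomputable def gaussianMeasure (n : ℕ) (Λ : Matrix (Fin n) (Fin n) ℝ) :
    Measure (Fin n → ℝ) :=
  volume.withDensity fun x => ENNReal.ofReal (gaussianPdf n Λ x)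

/-- The minimal type-II error `β_τ = inf { q B : B measurable, p Bᶜ < τ }`. -/
noncomputable def minTypeIIError {X : Type*} [MeasurableSpace X]
    (p q : Measure X) (τ : ℝ) : ENNReal :=
  sInf {v | ∃ B : Set X, MeasurableSet B ∧ p Bᶜ < ENNReal.ofReal τ ∧ v = q B}

section LinearAlgebra

variable {ι : Type*} [Fintype ι]

lemma dotProduct_sq_le (u v : ι → ℝ) : (u ⬝ᵥ v) ^ 2 ≤ (u ⬝ᵥ u) * (v ⬝ᵥ v) := by
  have := Finset.sum_mul_sq_le_sq_mul_sq Finset.univ u v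
  simpa only [dotProduct, sq] using this

lemma dotProduct_self_nonneg' (u : ι → ℝ) : 0 ≤ u ⬝ᵥ u :=
  Finset.sum_nonneg fun i _ => mul_self_nonneg (u i)

lemma abs_bilin_le {A : Matrix ι ι ℝ} (hA : Aᵀ = A) {M b : ℝ} (hM : 0 ≤ M)
    (h0 : ∀ x, 0 ≤ x ⬝ᵥ (A *ᵥ x)) (h : ∀ x, x ⬝ᵥ (A *ᵥ x) ≤ M * (x ⬝ᵥ x))
    {u v : ι → ℝ} (hu : u ⬝ᵥ u ≤ b) (hv : v ⬝ᵥ v ≤ b) : |u ⬝ᵥ (A *ᵥ v)| ≤ M * b := by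
  have hs : v ⬝ᵥ (A *ᵥ u) = u ⬝ᵥ (A *ᵥ v) := by
    rw [dotProduct_mulVec, ← mulVec_transpose, hA, dotProduct_comm]
  have e1 := h0 (u + v)
  have e2 := h0 (u - v)
  have e3 := h u
  have e4 := h v
  simp only [mulVec_add, mulVec_sub, add_dotProduct, sub_dotProduct, dotProduct_add,
    dotProduct_sub, hs] at e1 e2
  have e5 := mul_le_mul_of_nonneg_left hu hM
  have e6 := mul_le_mul_of_nonneg_left hv hM
  rw [abs_le]; constructor <;> linarith

lemma posDef_of_form_lower_bound {A : Matrix ι ι ℝ} (hA : Aᵀ = A) {c : ℝ} (hc : 0 < c)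
    (h : ∀ x, c * (x ⬝ᵥ x) ≤ x ⬝ᵥ (A *ᵥ x)) : A.PosDef := by
  refine PosDef.of_dotProduct_mulVec_pos ?_ fun x hx => ?_
  · rw [IsHermitian, conjTranspose_eq_transpose_of_trivial, hA]
  · have h0 : 0 < x ⬝ᵥ x := by
      rcases (dotProduct_self_nonneg' x).lt_or_eq with h | h
      · exact h
      · exact absurd (dotProduct_self_eq_zero.1 h.symm) hx
    simpa using (mul_pos hc h0).trans_le (h x)

lemma abs_trace_mul_le {A E : Matrix ι ι ℝ} {b : ℝ} (hA : ∀ i j, |A i j| ≤ b) :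
    |(A * E).trace| ≤ b * ∑ i, ∑ j, |E i j| := by
  rw [Matrix.trace, Finset.sum_comm, Finset.mul_sum]
  simp only [diag_apply, mul_apply]
  refine (Finset.abs_sum_le_sum_abs _ _).trans (Finset.sum_le_sum fun i _ => ?_)
  refine (Finset.abs_sum_le_sum_abs _ _).trans ?_
  rw [Finset.mul_sum]
  refine Finset.sum_le_sum fun j _ => ?_
  rw [abs_mul]
  exact mul_le_mul_of_nonneg_right (hA _ _) (abs_nonneg _)

variable [DecidableEq ι]

lemma posDef_exists_orthogonal_diagonalization {A : Matrix ι ι ℝ} (hA : A.PosDef) :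
    ∃ (U : Matrix ι ι ℝ) (d : ι → ℝ), U * Uᵀ = 1 ∧ Uᵀ * A * U = diagonal d ∧ ∀ i, 0 < d i := by
  have h := hA.1.spectral_theorem
  set U : Matrix ι ι ℝ := (hA.1.eigenvectorUnitary).1 with hU
  have h1 : U * Uᵀ = 1 := by
    have := Unitary.mul_star_self_of_mem (hA.1.eigenvectorUnitary).2
    simpa [star_eq_conjTranspose, conjTranspose_eq_transpose_of_trivial] using this
  have h2 : Uᵀ * U = 1 := by
    exact mul_eq_one_comm.mp h1
  refine ⟨U, hA.1.eigenvalues, h1, ?_, hA.eigenvalues_pos⟩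
  have h3 : A = U * diagonal hA.1.eigenvalues * Uᵀ := by
    conv_lhs => rw [h]
    simp [Unitary.conjStarAlgAut_apply, star_eq_conjTranspose,
      conjTranspose_eq_transpose_of_trivial, hU]
  have h4 : Uᵀ * A * U = Uᵀ * (U * diagonal hA.1.eigenvalues * Uᵀ) * U :=
    congrArg (fun B => Uᵀ * B * U) h3
  rw [h4]
  simp only [Matrix.mul_assoc, h2, Matrix.mul_one]
  rw [← Matrix.mul_assoc, h2, Matrix.one_mul]

lemma posDef_exists_mul_transpose {A : Matrix ι ι ℝ} (hA : A.PosDef) :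
    ∃ R : Matrix ι ι ℝ, IsUnit R.det ∧ A = R * Rᵀ := by
  obtain ⟨U, d, hU, hd, hpos⟩ := posDef_exists_orthogonal_diagonalization hA
  have hU' := mul_eq_one_comm.mp hU
  refine ⟨U * diagonal (fun i => √(d i)), ?_, ?_⟩
  · rw [det_mul, det_diagonal]
    refine IsUnit.mul ?_ ?_
    · refine IsUnit.of_mul_eq_one (Uᵀ.det) ?_
      rw [← det_mul, hU, det_one]
    · exact (Finset.prod_pos fun i _ => Real.sqrt_pos.2 (hpos i)).ne'.isUnit
  · have : diagonal (fun i => √(d i)) * diagonal (fun i => √(d i)) = diagonal d := by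
      rw [diagonal_mul_diagonal]
      congr 1; ext i; exact Real.mul_self_sqrt (hpos i).le
    rw [transpose_mul, diagonal_transpose, Matrix.mul_assoc, ← Matrix.mul_assoc (diagonal _), this,
      ← hd]
    simp only [Matrix.mul_assoc, hU, Matrix.mul_one]
    rw [← Matrix.mul_assoc, hU, Matrix.one_mul]

lemma posDef_simultaneous_diagonalization {P Q : Matrix ι ι ℝ} (hP : P.PosDef) (hQ : Q.PosDef) :
    ∃ (T : Matrix ι ι ℝ) (d : ι → ℝ), IsUnit T.det ∧ P = T * Tᵀ ∧
      Tᵀ * Q⁻¹ * T = diagonal d ∧ ∀ i, 0 < d i := by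
  obtain ⟨R, hR, hPR⟩ := posDef_exists_mul_transpose hP
  have h1 : (Rᵀ * Q⁻¹ * R).PosDef := by
    have := hQ.inv.conjTranspose_mul_mul_same (B := R)
      (Matrix.mulVec_injective_iff_isUnit.2 ((Matrix.isUnit_iff_isUnit_det R).2 hR))
    rwa [conjTranspose_eq_transpose_of_trivial] at this
  obtain ⟨U, d, hU, hd, hpos⟩ := posDef_exists_orthogonal_diagonalization h1
  refine ⟨R * U, d, ?_, ?_, ?_, hpos⟩
  · rw [det_mul]
    refine hR.mul (IsUnit.of_mul_eq_one (Uᵀ.det) ?_)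
    rw [← det_mul, hU, det_one]
  · rw [transpose_mul, Matrix.mul_assoc, ← Matrix.mul_assoc U, hU, Matrix.one_mul, hPR]
  · rw [← hd, transpose_mul]
    simp only [Matrix.mul_assoc]

lemma det_div_det_of_simultaneous {P Q T : Matrix ι ι ℝ} {d : ι → ℝ}
    (hP : P = T * Tᵀ) (hd : Tᵀ * Q⁻¹ * T = diagonal d) : P.det / Q.det = ∏ i, d i := by
  have h := congrArg det hd
  rw [det_mul, det_mul, det_diagonal, det_transpose, det_nonsing_inv, Ring.inverse_eq_inv'] at h
  rw [← h, hP, det_mul, det_transpose]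
  ring

lemma trace_inv_mul_of_simultaneous {P Q T : Matrix ι ι ℝ} {d : ι → ℝ}
    (hP : P = T * Tᵀ) (hd : Tᵀ * Q⁻¹ * T = diagonal d) : (Q⁻¹ * P).trace = ∑ i, d i := by
  rw [hP, ← Matrix.mul_assoc, trace_mul_comm, ← Matrix.mul_assoc, hd, trace_diagonal]

lemma log_det_sub_log_det_le {P Q : Matrix ι ι ℝ} (hP : P.PosDef) (hQ : Q.PosDef) :
    Real.log P.det - Real.log Q.det ≤ (Q⁻¹ * (P - Q)).trace := by
  obtain ⟨T, d, -, hPT, hd, hpos⟩ := posDef_simultaneous_diagonalization hP hQ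
  have hdet := det_div_det_of_simultaneous hPT hd
  have htr := trace_inv_mul_of_simultaneous hPT hd
  have hu : IsUnit Q.det := hQ.det_pos.ne'.isUnit
  rw [← Real.log_div hP.det_pos.ne' hQ.det_pos.ne', hdet, Real.log_prod (fun i _ => (hpos i).ne'),
    Matrix.mul_sub, nonsing_inv_mul _ hu, trace_sub, htr, trace_one, Fintype.card,
    Finset.cast_card, ← Finset.sum_sub_distrib]
  exact Finset.sum_le_sum fun i _ => Real.log_le_sub_one_of_pos (hpos i)

/-- The inverse of a matrix with form bounded below by `c` contracts by `c⁻¹`. -/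
lemma inv_mulVec_dotProduct_self_le {A : Matrix ι ι ℝ} (hu : IsUnit A.det) {c : ℝ} (hc : 0 < c)
    (h : ∀ x, c * (x ⬝ᵥ x) ≤ x ⬝ᵥ (A *ᵥ x)) (x : ι → ℝ) :
    (A⁻¹ *ᵥ x) ⬝ᵥ (A⁻¹ *ᵥ x) ≤ (x ⬝ᵥ x) / c ^ 2 := by
  set y := A⁻¹ *ᵥ x with hy
  have hx : A *ᵥ y = x := by rw [hy, mulVec_mulVec, mul_nonsing_inv _ hu, one_mulVec]
  have h1 := h y
  rw [hx] at h1
  have h2 := dotProduct_sq_le y x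
  have h3 := dotProduct_self_nonneg' y
  rw [le_div_iff₀ (by positivity)]
  rcases h3.lt_or_eq with h4 | h4
  · have h5 : (c * (y ⬝ᵥ y)) ^ 2 ≤ (y ⬝ᵥ y) * (x ⬝ᵥ x) :=
      (pow_le_pow_left₀ (by positivity) h1 2).trans h2
    refine le_of_mul_le_mul_left ?_ h4
    nlinarith
  · rw [← h4, zero_mul]; exact dotProduct_self_nonneg' x

lemma abs_inv_apply_le {A : Matrix ι ι ℝ} (hu : IsUnit A.det) {c : ℝ} (hc : 0 < c)
    (h : ∀ x, c * (x ⬝ᵥ x) ≤ x ⬝ᵥ (A *ᵥ x)) (i j : ι) : |A⁻¹ i j| ≤ 1 / c := by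
  have h1 := inv_mulVec_dotProduct_self_le hu hc h (Pi.single j 1)
  have h2 := dotProduct_sq_le (Pi.single i 1) (A⁻¹ *ᵥ Pi.single j 1)
  simp only [single_dotProduct, one_mul, Pi.single_eq_same, mulVec_single_one, col_apply] at h1 h2
  refine abs_le_of_sq_le_sq ?_ (by positivity)
  calc _ ≤ _ := h2
    _ ≤ _ := h1
    _ = _ := by ring

lemma abs_inv_mul_mul_inv_apply_le {A B P : Matrix ι ι ℝ} (hA : IsUnit A.det) (hB : IsUnit B.det)
    (hAs : Aᵀ = A) (hP : Pᵀ = P) {c M : ℝ} (hc : 0 < c) (hM : 0 ≤ M)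
    (h : ∀ x, c * (x ⬝ᵥ x) ≤ x ⬝ᵥ (A *ᵥ x)) (h' : ∀ x, c * (x ⬝ᵥ x) ≤ x ⬝ᵥ (B *ᵥ x))
    (h0 : ∀ x, 0 ≤ x ⬝ᵥ (P *ᵥ x)) (h1 : ∀ x, x ⬝ᵥ (P *ᵥ x) ≤ M * (x ⬝ᵥ x)) (i j : ι) :
    |(A⁻¹ * P * B⁻¹) i j| ≤ M / c ^ 2 := by
  have e : (A⁻¹ * P * B⁻¹) i j =
      (A⁻¹ *ᵥ Pi.single i 1) ⬝ᵥ (P *ᵥ (B⁻¹ *ᵥ Pi.single j 1)) := by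
    have : A⁻¹ *ᵥ Pi.single i 1 = Pi.single i 1 ᵥ* A⁻¹ := by
      rw [← mulVec_transpose, transpose_nonsing_inv, hAs]
    rw [this, ← dotProduct_mulVec, mulVec_mulVec, mulVec_mulVec]
    simp [Matrix.mul_assoc]
  have h2 := inv_mulVec_dotProduct_self_le hA hc h (Pi.single i 1)
  have h3 := inv_mulVec_dotProduct_self_le hB hc h' (Pi.single j 1)
  rw [single_dotProduct, Pi.single_eq_same, one_mul] at h2 h3
  rw [e, div_eq_mul_one_div]
  exact abs_bilin_le hP hM h0 h1 h2 h3

lemma abs_log_det_sub_log_det_le {P Q : Matrix ι ι ℝ} (hP : P.PosDef) (hQ : Q.PosDef)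
    {c : ℝ} (hc : 0 < c) (h : ∀ x, c * (x ⬝ᵥ x) ≤ x ⬝ᵥ (P *ᵥ x))
    (h' : ∀ x, c * (x ⬝ᵥ x) ≤ x ⬝ᵥ (Q *ᵥ x)) :
    |Real.log P.det - Real.log Q.det| ≤ 1 / c * ∑ i, ∑ j, |(P - Q) i j| := by
  have e1 := log_det_sub_log_det_le hP hQ
  have e2 := log_det_sub_log_det_le hQ hP
  have e3 := abs_trace_mul_le (E := P - Q) (abs_inv_apply_le hQ.det_pos.ne'.isUnit hc h')
  have e4 := abs_trace_mul_le (E := Q - P) (abs_inv_apply_le hP.det_pos.ne'.isUnit hc h)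
  have e5 : ∑ i, ∑ j, |(Q - P) i j| = ∑ i, ∑ j, |(P - Q) i j| := by
    simp only [Matrix.sub_apply, abs_sub_comm]
  rw [e5] at e4
  rw [abs_le]
  constructor
  · linarith [le_abs_self (P⁻¹ * (Q - P)).trace]
  · linarith [le_abs_self (Q⁻¹ * (P - Q)).trace]

/-- Twice the Kullback-Leibler divergence between the centered Gaussians with covariances
`P` and `Q`. -/
noncomputable def gaussianDivergence (P Q : Matrix ι ι ℝ) : ℝ :=
  (Q⁻¹ * P).trace - (Real.log P.det - Real.log Q.det) - Fintype.card ι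

lemma abs_gaussianDivergence_sub_le {P Q P' Q' : Matrix ι ι ℝ}
    (sP : Pᵀ = P) (sQ : Qᵀ = Q) (sP' : P'ᵀ = P') (sQ' : Q'ᵀ = Q')
    {c M : ℝ} (hc : 0 < c) (hM : 0 ≤ M)
    (lP : ∀ x, c * (x ⬝ᵥ x) ≤ x ⬝ᵥ (P *ᵥ x)) (lQ : ∀ x, c * (x ⬝ᵥ x) ≤ x ⬝ᵥ (Q *ᵥ x))
    (lP' : ∀ x, c * (x ⬝ᵥ x) ≤ x ⬝ᵥ (P' *ᵥ x)) (lQ' : ∀ x, c * (x ⬝ᵥ x) ≤ x ⬝ᵥ (Q' *ᵥ x))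
    (uP : ∀ x, x ⬝ᵥ (P *ᵥ x) ≤ M * (x ⬝ᵥ x)) :
    |gaussianDivergence P Q - gaussianDivergence P' Q'| ≤
      2 / c * ∑ i, ∑ j, |(P - P') i j| + (M / c ^ 2 + 1 / c) * ∑ i, ∑ j, |(Q - Q') i j| := by
  have hP := posDef_of_form_lower_bound sP hc lP
  have hQ := posDef_of_form_lower_bound sQ hc lQ
  have hP' := posDef_of_form_lower_bound sP' hc lP'
  have hQ' := posDef_of_form_lower_bound sQ' hc lQ'
  have iQ : IsUnit Q.det := hQ.det_pos.ne'.isUnit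
  have iQ' : IsUnit Q'.det := hQ'.det_pos.ne'.isUnit
  have p0 : ∀ x, 0 ≤ x ⬝ᵥ (P *ᵥ x) := fun x =>
    (mul_nonneg hc.le (dotProduct_self_nonneg' x)).trans (lP x)
  have e1 := abs_log_det_sub_log_det_le hP hP' hc lP lP'
  have e2 := abs_log_det_sub_log_det_le hQ hQ' hc lQ lQ'
  have e3 := abs_trace_mul_le (E := Q - Q')
    (abs_inv_mul_mul_inv_apply_le iQ iQ' sQ sP hc hM lQ lQ' p0 uP)
  have e4 := abs_trace_mul_le (E := P - P') (abs_inv_apply_le iQ' hc lQ')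
  have key : (Q⁻¹ * P).trace - (Q'⁻¹ * P').trace =
      -(Q⁻¹ * P * Q'⁻¹ * (Q - Q')).trace + (Q'⁻¹ * (P - P')).trace := by
    have : (Q⁻¹ * P * Q'⁻¹ * (Q - Q')).trace = (Q'⁻¹ * P).trace - (Q⁻¹ * P).trace := by
      rw [Matrix.mul_sub, trace_sub]
      congr 1
      · rw [trace_mul_comm, ← Matrix.mul_assoc, ← Matrix.mul_assoc, mul_nonsing_inv _ iQ,
          Matrix.one_mul, trace_mul_comm]
      · rw [Matrix.mul_assoc, nonsing_inv_mul _ iQ', Matrix.mul_one]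
    rw [this, Matrix.mul_sub, trace_sub]; ring
  have : gaussianDivergence P Q - gaussianDivergence P' Q' =
      ((Q⁻¹ * P).trace - (Q'⁻¹ * P').trace) - (Real.log P.det - Real.log P'.det)
        + (Real.log Q.det - Real.log Q'.det) := by
    unfold gaussianDivergence; ring
  rw [this, key]
  have : 2 / c = 1 / c + 1 / c := by ring
  rw [this]
  rw [abs_le] at *
  constructor <;> nlinarith

/-- Diagonal values of a simultaneous diagonalization are bounded by the ratio of form bounds. -/
lemma simultaneous_diagonal_le {P Q T : Matrix ι ι ℝ} {d : ι → ℝ} (iQ : IsUnit Q.det)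
    (hP : P = T * Tᵀ) (hd : Tᵀ * Q⁻¹ * T = diagonal d) {c M : ℝ} (hc : 0 < c) (hM : 0 ≤ M)
    (lQ : ∀ x, c * (x ⬝ᵥ x) ≤ x ⬝ᵥ (Q *ᵥ x)) (uP : ∀ x, x ⬝ᵥ (P *ᵥ x) ≤ M * (x ⬝ᵥ x)) (i : ι) :
    d i ≤ M / c := by
  set t := T *ᵥ Pi.single i 1 with ht
  have e1 : d i = t ⬝ᵥ (Q⁻¹ *ᵥ t) := by
    have : d i = Pi.single i 1 ⬝ᵥ ((Tᵀ * Q⁻¹ * T) *ᵥ Pi.single i 1) := by simp [hd]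
    rw [this, ← mulVec_mulVec, ← mulVec_mulVec, dotProduct_mulVec, vecMul_transpose]
  have e2 : t ⬝ᵥ t ≤ M := by
    have h1 := uP t
    have h2 : t ⬝ᵥ (P *ᵥ t) = (Tᵀ *ᵥ t) ⬝ᵥ (Tᵀ *ᵥ t) := by
      rw [hP, ← mulVec_mulVec, dotProduct_mulVec, ← mulVec_transpose]
    have h3 : t ⬝ᵥ t = Pi.single i 1 ⬝ᵥ (Tᵀ *ᵥ t) := by
      rw [dotProduct_mulVec, ← mulVec_transpose, dotProduct_comm]
    have h4 := dotProduct_sq_le (Pi.single i 1) (Tᵀ *ᵥ t)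
    rw [← h3, ← h2, single_dotProduct, Pi.single_eq_same, one_mul, one_mul] at h4
    have h5 := dotProduct_self_nonneg' t
    nlinarith
  have e3 := inv_mulVec_dotProduct_self_le iQ hc lQ t
  have e4 := dotProduct_sq_le t (Q⁻¹ *ᵥ t)
  have h5 := dotProduct_self_nonneg' t
  rw [e1]
  refine le_trans (abs_le_of_sq_le_sq' (b := (t ⬝ᵥ t) / c) ?_ (by positivity)).2 (by gcongr)
  calc _ ≤ _ := e4
    _ ≤ (t ⬝ᵥ t) * ((t ⬝ᵥ t) / c ^ 2) := by gcongr
    _ = _ := by ring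

end LinearAlgebra

section Circulant

lemma sum_cexp_range {N : ℕ} (hN : 0 < N) (m : ℤ) :
    ∑ k ∈ Finset.range N, Complex.exp (((2 * Real.pi * k * m / N : ℝ) : ℂ) * Complex.I) =
      if (N : ℤ) ∣ m then (N : ℂ) else 0 := by
  have hN' : (N : ℂ) ≠ 0 := by exact_mod_cast hN.ne'
  set z := Complex.exp (2 * Real.pi * m / N * Complex.I) with hz
  have h1 : ∀ k : ℕ, Complex.exp (((2 * Real.pi * k * m / N : ℝ) : ℂ) * Complex.I) = z ^ k := by
    intro k
    rw [hz, ← Complex.exp_nat_mul]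
    congr 1; push_cast; ring
  have hzN : z ^ N = 1 := by
    rw [hz, ← Complex.exp_nat_mul, Complex.exp_eq_one_iff]
    exact ⟨m, by field_simp⟩
  have hz1 : z = 1 ↔ (N : ℤ) ∣ m := by
    rw [hz, Complex.exp_eq_one_iff]
    have hpi : (2 * Real.pi * Complex.I : ℂ) ≠ 0 := Complex.two_pi_I_ne_zero
    constructor
    · rintro ⟨l, hl⟩
      refine ⟨l, ?_⟩
      have : (m : ℂ) * (2 * Real.pi * Complex.I) = (N * l) * (2 * Real.pi * Complex.I) := by
        field_simp at hl
        linear_combination (2 * Real.pi * Complex.I) * hl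
      exact_mod_cast mul_right_cancel₀ hpi this
    · rintro ⟨l, rfl⟩
      exact ⟨l, by push_cast; field_simp⟩
  simp only [h1]
  split_ifs with h
  · simp [hz1.2 h]
  · have := geom_sum_eq (mt hz1.1 h) N
    rw [this, hzN]; simp

lemma sum_cos_range {N : ℕ} (hN : 0 < N) (m : ℤ) :
    ∑ k ∈ Finset.range N, Real.cos (2 * Real.pi * k * m / N) =
      if (N : ℤ) ∣ m then (N : ℝ) else 0 := by
  have := congrArg Complex.re (sum_cexp_range hN m)
  rw [Complex.re_sum] at this
  simp only [Complex.exp_ofReal_mul_I_re] at this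
  rw [this]; split_ifs <;> simp

lemma sum_sin_range {N : ℕ} (hN : 0 < N) (m : ℤ) :
    ∑ k ∈ Finset.range N, Real.sin (2 * Real.pi * k * m / N) = 0 := by
  have := congrArg Complex.im (sum_cexp_range hN m)
  rw [Complex.im_sum] at this
  simp only [Complex.exp_ofReal_mul_I_im] at this
  rw [this]; split_ifs <;> simp

/-- The kernel of the discrete Hartley transform of length `N`. -/
noncomputable def hartley (N i k : ℕ) : ℝ :=
  Real.cos (2 * Real.pi * k * i / N) + Real.sin (2 * Real.pi * k * i / N)

lemma hartley_comm (N i k : ℕ) : hartley N i k = hartley N k i := by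
  unfold hartley
  rw [show 2 * Real.pi * k * i / N = 2 * Real.pi * i * k / N by ring]

lemma hartley_mul (N i j k : ℕ) : hartley N i k * hartley N j k =
    Real.cos (2 * Real.pi * k * ((i - j : ℤ) : ℝ) / N) +
      Real.sin (2 * Real.pi * k * ((i + j : ℤ) : ℝ) / N) := by
  have e1 : 2 * Real.pi * k * ((i - j : ℤ) : ℝ) / N =
      2 * Real.pi * k * i / N - 2 * Real.pi * k * j / N := by push_cast; ring
  have e2 : 2 * Real.pi * k * ((i + j : ℤ) : ℝ) / N =
      2 * Real.pi * k * i / N + 2 * Real.pi * k * j / N := by push_cast; ring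
  rw [e1, e2, Real.cos_sub, Real.sin_add]
  unfold hartley; ring

lemma sum_hartley_mul {N : ℕ} (hN : 0 < N) (i j : ℕ) :
    ∑ k ∈ Finset.range N, hartley N i k * hartley N j k =
      if (N : ℤ) ∣ (i : ℤ) - j then (N : ℝ) else 0 := by
  simp only [hartley_mul, Finset.sum_add_distrib]
  rw [sum_cos_range hN, sum_sin_range hN, add_zero]

lemma sum_hartley_mul_of_lt {N : ℕ} {i j : ℕ} (hi : i < N) (hj : j < N) :
    ∑ k ∈ Finset.range N, hartley N i k * hartley N j k = if i = j then (N : ℝ) else 0 := by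
  rw [sum_hartley_mul (by omega)]
  congr 1
  rw [eq_iff_iff]
  constructor
  · intro h
    have := Int.eq_zero_of_abs_lt_dvd h (by rw [abs_lt]; omega)
    omega
  · rintro rfl; simp

/-- Entries of the circulant-type matrix whose eigenvalues are the samples `S (k / N)`. -/
noncomputable def circ (S : ℝ → ℝ) (N i j : ℕ) : ℝ :=
  (∑ k ∈ Finset.range N, S (k / N) * (hartley N i k * hartley N j k)) / N

lemma circ_form {n : ℕ} (S : ℝ → ℝ) (N : ℕ) (x : Fin n → ℝ) :
    ∑ i, ∑ j, x i * x j * circ S N i j =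
      (∑ k ∈ Finset.range N, S (k / N) * (∑ i, x i * hartley N i k) ^ 2) / N := by
  have h : ∀ k : ℕ, S (k / N) * (∑ i, x i * hartley N i k) ^ 2 =
      ∑ i, ∑ j, x i * x j * (S (k / N) * (hartley N i k * hartley N j k)) := by
    intro k
    rw [sq, Finset.sum_mul_sum, Finset.mul_sum]
    refine Finset.sum_congr rfl fun i _ => ?_
    rw [Finset.mul_sum]
    exact Finset.sum_congr rfl fun j _ => by ring
  simp only [h]
  symm
  rw [Finset.sum_comm, Finset.sum_div]
  refine Finset.sum_congr rfl fun i _ => ?_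
  rw [Finset.sum_comm, Finset.sum_div]
  refine Finset.sum_congr rfl fun j _ => ?_
  rw [circ, ← Finset.mul_sum, mul_div_assoc]

lemma circ_form_one {n N : ℕ} (hnN : n ≤ N) (x : Fin n → ℝ) :
    (∑ k ∈ Finset.range N, (∑ i, x i * hartley N i k) ^ 2) / N = x ⬝ᵥ x := by
  have h := circ_form (fun _ => 1) N x
  simp only [one_mul] at h
  rw [← h, dotProduct]
  refine Finset.sum_congr rfl fun i _ => ?_
  have hN : (N : ℝ) ≠ 0 := by
    have := i.2
    exact_mod_cast (by omega : N ≠ 0)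
  rw [Finset.sum_eq_single i]
  · simp only [circ, one_mul]
    rw [sum_hartley_mul_of_lt (i.2.trans_le hnN) (i.2.trans_le hnN), if_pos rfl, div_self hN,
      mul_one]
  · intro j _ hj
    simp only [circ, one_mul]
    rw [sum_hartley_mul_of_lt (i.2.trans_le hnN) (j.2.trans_le hnN), if_neg]
    · simp
    · exact fun h => hj (Fin.ext h.symm)
  · simp

lemma div_mem_unitInterval_of_lt {k N : ℕ} (h : k < N) : (k / N : ℝ) ∈ Set.Icc (0 : ℝ) 1 := by
  refine ⟨by positivity, div_le_one_of_le₀ (by exact_mod_cast h.le) (by positivity)⟩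

lemma le_circ_form {n N : ℕ} (hnN : n ≤ N) {S : ℝ → ℝ} {c : ℝ}
    (hS : ∀ f ∈ Set.Icc (0 : ℝ) 1, c ≤ S f) (x : Fin n → ℝ) :
    c * (x ⬝ᵥ x) ≤ ∑ i, ∑ j, x i * x j * circ S N i j := by
  rw [circ_form, ← circ_form_one hnN x, ← mul_div_assoc, Finset.mul_sum]
  gcongr with k hk
  exact hS _ (div_mem_unitInterval_of_lt (Finset.mem_range.1 hk))

lemma circ_form_le {n N : ℕ} (hnN : n ≤ N) {S : ℝ → ℝ} {M : ℝ}
    (hS : ∀ f ∈ Set.Icc (0 : ℝ) 1, S f ≤ M) (x : Fin n → ℝ) :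
    ∑ i, ∑ j, x i * x j * circ S N i j ≤ M * (x ⬝ᵥ x) := by
  rw [circ_form, ← circ_form_one hnN x, ← mul_div_assoc, Finset.mul_sum]
  gcongr with k hk
  exact hS _ (div_mem_unitInterval_of_lt (Finset.mem_range.1 hk))

/-- Indicator that `m` differs from `r` but agrees with it modulo `N`. -/
noncomputable def wrap (N : ℕ) (r m : ℤ) : ℝ := if (N : ℤ) ∣ m - r ∧ m ≠ r then 1 else 0

lemma wrap_nonneg (N : ℕ) (r m : ℤ) : 0 ≤ wrap N r m := by unfold wrap; split_ifs <;> simp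

lemma wrap_le_one (N : ℕ) (r m : ℤ) : wrap N r m ≤ 1 := by unfold wrap; split_ifs <;> simp

variable {K : ℤ → ℝ}

lemma hasSum_spectrum' (hK : Summable fun m : ℤ => |K m|) (f : ℝ) :
    HasSum (fun m : ℤ => K m * Real.cos (2 * Real.pi * f * (m : ℝ))) (spectrum' K f) := by
  refine Summable.hasSum (Summable.of_norm_bounded hK fun m => ?_)
  rw [norm_mul]
  exact mul_le_of_le_one_right (abs_nonneg _) (Real.abs_cos_le_one _)

lemma continuous_spectrum' (hK : Summable fun m : ℤ => |K m|) : Continuous (spectrum' K) := by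
  refine continuous_tsum (fun m => by fun_prop) hK fun m x => ?_
  rw [norm_mul]
  exact mul_le_of_le_one_right (abs_nonneg _) (Real.abs_cos_le_one _)

lemma sum_cos_mul_hartley {N : ℕ} (hN : 0 < N) (i j : ℕ) (m : ℤ) :
    ∑ k ∈ Finset.range N, Real.cos (2 * Real.pi * (k / N) * m) * (hartley N i k * hartley N j k) =
      ((if (N : ℤ) ∣ m - (i - j) then (N : ℝ) else 0) +
        (if (N : ℤ) ∣ -m - (i - j) then (N : ℝ) else 0)) / 2 := by
  have h : ∀ k : ℕ, Real.cos (2 * Real.pi * (k / N) * m) * (hartley N i k * hartley N j k) =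
      (Real.cos (2 * Real.pi * k * ((m - (i - j) : ℤ) : ℝ) / N) +
        Real.cos (2 * Real.pi * k * ((-m - (i - j) : ℤ) : ℝ) / N) +
        Real.sin (2 * Real.pi * k * ((m + (i + j) : ℤ) : ℝ) / N) +
        Real.sin (2 * Real.pi * k * ((-m + (i + j) : ℤ) : ℝ) / N)) / 2 := by
    intro k
    rw [hartley_mul]
    set a := 2 * Real.pi * (k / N) * m
    set b := 2 * Real.pi * k * ((i - j : ℤ) : ℝ) / N
    set d := 2 * Real.pi * k * ((i + j : ℤ) : ℝ) / N
    have e1 : 2 * Real.pi * k * ((m - (i - j) : ℤ) : ℝ) / N = a - b := by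
      simp only [a, b]; push_cast; ring
    have e2 : 2 * Real.pi * k * ((-m - (i - j) : ℤ) : ℝ) / N = -(a + b) := by
      simp only [a, b]; push_cast; ring
    have e3 : 2 * Real.pi * k * ((m + (i + j) : ℤ) : ℝ) / N = a + d := by
      simp only [a, d]; push_cast; ring
    have e4 : 2 * Real.pi * k * ((-m + (i + j) : ℤ) : ℝ) / N = -(a - d) := by
      simp only [a, d]; push_cast; ring
    rw [e1, e2, e3, e4, Real.cos_neg, Real.sin_neg, Real.cos_add, Real.cos_sub, Real.sin_add,
      Real.sin_sub]
    ring
  simp only [h]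
  rw [← Finset.sum_div, Finset.sum_add_distrib, Finset.sum_add_distrib, Finset.sum_add_distrib,
    sum_cos_range hN, sum_cos_range hN, sum_sin_range hN, sum_sin_range hN, add_zero, add_zero]

lemma hasSum_circ (hev : ∀ m, K (-m) = K m) (hK : Summable fun m : ℤ => |K m|) {N : ℕ}
    (hN : 0 < N) (i j : ℕ) :
    HasSum (fun m : ℤ => K m * (if (N : ℤ) ∣ m - (i - j) then 1 else 0))
      (circ (spectrum' K) N i j) := by
  have hN' : (N : ℝ) ≠ 0 := by exact_mod_cast hN.ne'
  set F : ℤ → ℝ := fun m => K m * (if (N : ℤ) ∣ m - (i - j) then 1 else 0) with hF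
  have hs : Summable F := by
    refine Summable.of_norm_bounded hK fun m => ?_
    rw [hF, norm_mul]
    refine mul_le_of_le_one_right (abs_nonneg _) ?_
    split_ifs <;> simp
  have h1 : HasSum (fun m : ℤ => (∑ k ∈ Finset.range N,
      K m * Real.cos (2 * Real.pi * (k / N) * m) * (hartley N i k * hartley N j k)) / N)
      (circ (spectrum' K) N i j) := by
    rw [circ]
    have h0 := hasSum_sum (s := Finset.range N)
      (f := fun (k : ℕ) (m : ℤ) =>
        K m * Real.cos (2 * Real.pi * (k / N) * m) * (hartley N i k * hartley N j k))
      (a := fun k : ℕ => spectrum' K (k / N) * (hartley N i k * hartley N j k))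
      fun k _ => (hasSum_spectrum' hK ((k : ℝ) / (N : ℝ))).mul_right _
    exact h0.div_const _
  have h2 : ∀ m : ℤ, (∑ k ∈ Finset.range N,
      K m * Real.cos (2 * Real.pi * (k / N) * m) * (hartley N i k * hartley N j k)) / N =
      (F m + F (-m)) / 2 := by
    intro m
    have e : ∀ (p : Prop) [Decidable p],
        (if p then (N : ℝ) else 0) = (if p then 1 else 0) * N := by
      intro p _; split_ifs <;> simp
    have e2 : F (-m) = K m * (if (N : ℤ) ∣ -m - (i - j) then 1 else 0) := by
      rw [← hev m]
    simp only [mul_assoc (K m)]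
    rw [← Finset.mul_sum, sum_cos_mul_hartley hN, e, e, e2, div_eq_iff hN']
    simp only [hF]
    ring
  simp only [h2] at h1
  have h3 : HasSum (fun m => (F m + F (-m)) / 2) ((∑' m, F m + ∑' m, F m) / 2) :=
    (hs.hasSum.add ((Equiv.neg ℤ).hasSum_iff.2 hs.hasSum)).div_const 2
  have h4 := h1.unique h3
  rw [h4, add_self_div_two]
  exact hs.hasSum

lemma summable_mul_wrap (hK : Summable fun m : ℤ => |K m|) (N : ℕ) (r : ℤ) :
    Summable fun m => |K m| * wrap N r m :=
  Summable.of_nonneg_of_le (fun _ => mul_nonneg (abs_nonneg _) (wrap_nonneg _ _ _))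
    (fun _ => mul_le_of_le_one_right (abs_nonneg _) (wrap_le_one _ _ _)) hK

lemma abs_circ_sub_le (hev : ∀ m, K (-m) = K m) (hK : Summable fun m : ℤ => |K m|) {N : ℕ}
    (hN : 0 < N) (i j : ℕ) :
    |circ (spectrum' K) N i j - K (i - j)| ≤ ∑' m, |K m| * wrap N (i - j) m := by
  have h1 := hasSum_circ hev hK hN i j
  have h2 : HasSum (fun m : ℤ => K m * (if m = i - j then 1 else 0)) (K (i - j)) := by
    convert hasSum_ite_eq ((i : ℤ) - j) (K (i - j)) using 2 with l
    by_cases h : l = i - j <;> simp [h]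
  have h3 := h1.sub h2
  have h4 : ∀ m : ℤ, K m * (if (N : ℤ) ∣ m - (i - j) then 1 else 0) -
      K m * (if m = i - j then 1 else 0) = K m * wrap N (i - j) m := by
    intro m
    unfold wrap
    by_cases h : m = i - j <;> simp [h]
  simp only [h4] at h3
  rw [← h3.tsum_eq, ← Real.norm_eq_abs]
  have h5 := summable_mul_wrap hK N (i - j)
  refine (norm_tsum_le_tsum_norm ?_).trans_eq ?_ <;>
    simp only [norm_mul, Real.norm_eq_abs, abs_of_nonneg (wrap_nonneg _ _ _)]
  exact h5

lemma tendsto_circ (hev : ∀ m, K (-m) = K m) (hK : Summable fun m : ℤ => |K m|) (i j : ℕ) :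
    Tendsto (fun N => circ (spectrum' K) N i j) atTop (nhds (K (i - j))) := by
  rw [tendsto_iff_norm_sub_tendsto_zero]
  have h : Tendsto (fun N => ∑' m, |K m| * wrap N (i - j) m) atTop (nhds 0) := by
    have := tendsto_tsum_of_dominated_convergence (𝓕 := atTop)
      (f := fun N m => |K m| * wrap N (i - j) m) (g := fun _ => 0) hK ?_ ?_
    · simpa using this
    · intro m
      refine tendsto_const_nhds.congr' ?_
      filter_upwards [eventually_gt_atTop (m - (i - j)).natAbs] with N hN
      unfold wrap
      rw [if_neg, mul_zero]
      rintro ⟨h1, h2⟩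
      have := Int.eq_zero_of_abs_lt_dvd h1 (by rw [← Int.natCast_natAbs]; exact_mod_cast hN)
      omega
    · refine Eventually.of_forall fun N m => ?_
      rw [norm_mul, Real.norm_eq_abs, abs_abs, Real.norm_eq_abs, abs_of_nonneg (wrap_nonneg _ _ _)]
      exact mul_le_of_le_one_right (abs_nonneg _) (wrap_le_one _ _ _)
  refine squeeze_zero' (Eventually.of_forall fun _ => norm_nonneg _) ?_ h
  filter_upwards [eventually_gt_atTop 0] with N hN
  exact abs_circ_sub_le hev hK hN i j

lemma toeplitz_form (n : ℕ) (x : Fin n → ℝ) :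
    x ⬝ᵥ (toeplitz K n *ᵥ x) = ∑ i, ∑ j, x i * x j * K ((i : ℤ) - (j : ℤ)) := by
  simp only [dotProduct, mulVec, toeplitz, Finset.mul_sum]
  exact Finset.sum_congr rfl fun i _ => Finset.sum_congr rfl fun j _ => by ring

lemma tendsto_circ_form (hev : ∀ m, K (-m) = K m) (hK : Summable fun m : ℤ => |K m|) {n : ℕ}
    (x : Fin n → ℝ) :
    Tendsto (fun N => ∑ i, ∑ j, x i * x j * circ (spectrum' K) N i j) atTop
      (nhds (x ⬝ᵥ (toeplitz K n *ᵥ x))) := by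
  rw [toeplitz_form]
  exact tendsto_finsetSum _ fun i _ => tendsto_finsetSum _ fun j _ =>
    (tendsto_circ hev hK i j).const_mul _

lemma le_toeplitz_form (hev : ∀ m, K (-m) = K m) (hK : Summable fun m : ℤ => |K m|) {c : ℝ}
    (hS : ∀ f ∈ Set.Icc (0 : ℝ) 1, c ≤ spectrum' K f) {n : ℕ} (x : Fin n → ℝ) :
    c * (x ⬝ᵥ x) ≤ x ⬝ᵥ (toeplitz K n *ᵥ x) :=
  ge_of_tendsto (tendsto_circ_form hev hK x)
    ((eventually_ge_atTop n).mono fun _ h => le_circ_form h hS x)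

lemma toeplitz_form_le (hev : ∀ m, K (-m) = K m) (hK : Summable fun m : ℤ => |K m|) {M : ℝ}
    (hS : ∀ f ∈ Set.Icc (0 : ℝ) 1, spectrum' K f ≤ M) {n : ℕ} (x : Fin n → ℝ) :
    x ⬝ᵥ (toeplitz K n *ᵥ x) ≤ M * (x ⬝ᵥ x) :=
  le_of_tendsto (tendsto_circ_form hev hK x)
    ((eventually_ge_atTop n).mono fun _ h => circ_form_le h hS x)

lemma transpose_toeplitz (hev : ∀ m, K (-m) = K m) (n : ℕ) : (toeplitz K n)ᵀ = toeplitz K n := by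
  ext i j
  simp only [transpose_apply, toeplitz]
  rw [← hev, neg_sub]

end Circulant

section Asymptotics

lemma tendsto_riemann_sum {g : ℝ → ℝ} (hg : ContinuousOn g (Set.Icc 0 1)) :
    Tendsto (fun n : ℕ => (∑ k ∈ Finset.range n, g (k / n)) / n) atTop
      (nhds (∫ f in (0 : ℝ)..1, g f)) := by
  have huc := isCompact_Icc.uniformContinuousOn_of_continuous hg
  rw [Metric.uniformContinuousOn_iff_le] at huc
  rw [Metric.tendsto_atTop]
  intro ε hε
  obtain ⟨δ, hδ, h⟩ := huc (ε / 2) (by positivity)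
  obtain ⟨n₀, hn₀⟩ := exists_nat_gt (1 / δ)
  refine ⟨n₀ + 1, fun n hn => ?_⟩
  have hn0 : (0 : ℝ) < n := by exact_mod_cast (by omega : 0 < n)
  have hnδ : 1 / (n : ℝ) ≤ δ := by
    rw [div_le_comm₀ hn0 hδ]
    exact hn₀.le.trans (by exact_mod_cast (by omega : n₀ ≤ n))
  have hmem : ∀ k ∈ Finset.range n, Set.uIcc ((k : ℝ) / n) ((k + 1 : ℕ) / n) ⊆ Set.Icc 0 1 := by
    intro k hk
    rw [Finset.mem_range] at hk
    rw [Set.uIcc_of_le (by gcongr; omega)]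
    refine Set.Icc_subset_Icc (by positivity) ?_
    rw [div_le_one hn0]; exact_mod_cast hk
  have hint : ∀ k ∈ Finset.range n,
      IntervalIntegrable g volume ((k : ℝ) / n) ((k + 1 : ℕ) / n) := fun k hk =>
    (hg.mono (hmem k hk)).intervalIntegrable
  have hsum : ∑ k ∈ Finset.range n, ∫ f in ((k : ℝ) / n)..((k + 1 : ℕ) / n), g f =
      ∫ f in (0 : ℝ)..1, g f := by
    rw [intervalIntegral.sum_integral_adjacent_intervals (a := fun k : ℕ => (k : ℝ) / n)
      (fun k hk => hint k (Finset.mem_range.2 hk))]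
    simp [div_self hn0.ne']
  have hlen : ∀ k : ℕ, ((k + 1 : ℕ) : ℝ) / n - k / n = 1 / n := by
    intro k; push_cast; ring
  have hterm : ∀ k ∈ Finset.range n,
      |g (k / n) / n - ∫ f in ((k : ℝ) / n)..((k + 1 : ℕ) / n), g f| ≤ ε / 2 * (1 / n) := by
    intro k hk
    have e1 : g (k / n) / n = ∫ _ in ((k : ℝ) / n)..((k + 1 : ℕ) / n), g (k / n) := by
      rw [intervalIntegral.integral_const, hlen, smul_eq_mul]; ring
    rw [e1, ← intervalIntegral.integral_sub intervalIntegrable_const (hint k hk),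
      ← Real.norm_eq_abs]
    refine (intervalIntegral.norm_integral_le_of_norm_le_const (C := ε / 2) ?_).trans_eq ?_
    · intro x hx
      have hx' := Set.uIoc_subset_uIcc hx
      refine h _ (hmem k hk Set.left_mem_uIcc) x (hmem k hk hx') ?_
      refine le_trans ?_ hnδ
      rw [Set.uIcc_of_le (by gcongr; omega)] at hx'
      rw [dist_comm, Real.dist_eq, abs_of_nonneg (by linarith [hx'.1]), ← hlen k]
      linarith [hx'.2]
    · rw [hlen, abs_of_pos (by positivity)]
  rw [Real.dist_eq, ← hsum, Finset.sum_div, ← Finset.sum_sub_distrib]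
  calc _ ≤ ∑ k ∈ Finset.range n, ε / 2 * (1 / (n : ℝ)) :=
        (Finset.abs_sum_le_sum_abs _ _).trans (Finset.sum_le_sum hterm)
    _ = ε / 2 := by
        rw [Finset.sum_const, Finset.card_range, nsmul_eq_mul]; field_simp
    _ < ε := by linarith

lemma gaussianDivergence_of_diagonal {ι : Type*} [Fintype ι] [DecidableEq ι] {H : Matrix ι ι ℝ}
    (hH : H * H = 1) {a b : ι → ℝ} (ha : ∀ i, 0 < a i) (hb : ∀ i, 0 < b i) :
    gaussianDivergence (H * diagonal a * H) (H * diagonal b * H) =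
      ∑ i, (a i / b i - Real.log (a i / b i) - 1) := by
  have hmul : ∀ u v : ι → ℝ, (H * diagonal u * H) * (H * diagonal v * H) =
      H * diagonal (fun i => u i * v i) * H := by
    intro u v
    calc _ = H * diagonal u * (H * H) * diagonal v * H := by simp only [Matrix.mul_assoc]
      _ = _ := by rw [hH, Matrix.mul_one, Matrix.mul_assoc H, diagonal_mul_diagonal]
  have hinv : (H * diagonal b * H)⁻¹ = H * diagonal (fun i => (b i)⁻¹) * H := by
    refine inv_eq_right_inv ?_
    rw [hmul]
    have : (fun i => b i * (b i)⁻¹) = 1 := by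
      ext i; exact mul_inv_cancel₀ (hb i).ne'
    rw [this]
    simp [hH]
  have hdet : ∀ u : ι → ℝ, (H * diagonal u * H).det = ∏ i, u i := by
    intro u
    have : H.det * H.det = 1 := by rw [← det_mul, hH, det_one]
    rw [det_mul, det_mul, det_diagonal]
    linear_combination (∏ i, u i) * this
  have htr : ∀ u : ι → ℝ, (H * diagonal u * H).trace = ∑ i, u i := by
    intro u
    rw [trace_mul_comm, ← Matrix.mul_assoc, hH, Matrix.one_mul, trace_diagonal]
  unfold gaussianDivergence
  rw [hinv, hmul, hdet, hdet, htr, Real.log_prod fun i _ => (ha i).ne',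
    Real.log_prod fun i _ => (hb i).ne', ← Finset.sum_sub_distrib, ← Finset.sum_sub_distrib,
    Fintype.card, Finset.cast_card, ← Finset.sum_sub_distrib]
  refine Finset.sum_congr rfl fun i _ => ?_
  rw [Real.log_div (ha i).ne' (hb i).ne']
  ring

/-- The circulant-type matrix with eigenvalues `S (k / n)`. -/
noncomputable def circMatrix (S : ℝ → ℝ) (n : ℕ) : Matrix (Fin n) (Fin n) ℝ :=
  fun i j => circ S n i j

noncomputable def hartleyMatrix (n : ℕ) : Matrix (Fin n) (Fin n) ℝ :=
  fun i k => hartley n i k / √n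

lemma hartleyMatrix_mul_self (n : ℕ) : hartleyMatrix n * hartleyMatrix n = 1 := by
  ext i j
  have hn : (0 : ℝ) < n := by exact_mod_cast i.pos
  simp only [mul_apply, hartleyMatrix, div_mul_div_comm, Real.mul_self_sqrt hn.le]
  rw [← Finset.sum_div]
  simp only [hartley_comm n _ (j : ℕ)]
  rw [Fin.sum_univ_eq_sum_range (fun k => hartley n i k * hartley n j k),
    sum_hartley_mul_of_lt i.2 j.2, one_apply]
  by_cases h : i = j
  · simp [h, hn.ne']
  · rw [if_neg h, if_neg fun h' => h (Fin.ext h'), zero_div]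

lemma circMatrix_eq (S : ℝ → ℝ) (n : ℕ) : circMatrix S n =
    hartleyMatrix n * diagonal (fun k : Fin n => S (k / n)) * hartleyMatrix n := by
  ext i j
  have hn : (0 : ℝ) < n := by exact_mod_cast i.pos
  rw [mul_apply]
  simp only [mul_diagonal, circMatrix, circ, hartleyMatrix]
  rw [← Fin.sum_univ_eq_sum_range (fun k => S (k / n) * (hartley n i k * hartley n j k)),
    Finset.sum_div]
  refine Finset.sum_congr rfl fun k _ => ?_
  rw [hartley_comm n k j, div_eq_iff hn.ne']
  have := Real.mul_self_sqrt hn.le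
  have h0 := (Real.sqrt_pos.2 hn).ne'
  field_simp
  rw [sq, this]
  ring

lemma transpose_circMatrix (S : ℝ → ℝ) (n : ℕ) : (circMatrix S n)ᵀ = circMatrix S n := by
  ext i j
  simp only [transpose_apply, circMatrix, circ]
  congr 1
  exact Finset.sum_congr rfl fun k _ => by ring

lemma circMatrix_form (S : ℝ → ℝ) (n : ℕ) (x : Fin n → ℝ) :
    x ⬝ᵥ (circMatrix S n *ᵥ x) = ∑ i, ∑ j, x i * x j * circ S n i j := by
  simp only [dotProduct, mulVec, circMatrix, Finset.mul_sum]
  exact Finset.sum_congr rfl fun i _ => Finset.sum_congr rfl fun j _ => by ring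

lemma sum_wrap_le_one (n i : ℕ) (m : ℤ) : ∑ j ∈ Finset.range n, wrap n (i - j) m ≤ 1 := by
  unfold wrap
  rw [← Finset.sum_filter, Finset.sum_const, nsmul_one, Nat.cast_le_one, Finset.card_le_one]
  intro a ha b hb
  simp only [Finset.mem_filter, Finset.mem_range] at ha hb
  have h := dvd_sub ha.2.1 hb.2.1
  have := Int.eq_zero_of_abs_lt_dvd h (by rw [abs_lt]; omega)
  omega

lemma sum_wrap_eq_zero {n i : ℕ} {m : ℤ} (h0 : 0 ≤ i - m) (h1 : i - m < n) :
    ∑ j ∈ Finset.range n, wrap n (i - j) m = 0 := by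
  refine Finset.sum_eq_zero fun j hj => ?_
  rw [Finset.mem_range] at hj
  unfold wrap
  rw [if_neg]
  rintro ⟨h2, h3⟩
  have := Int.eq_zero_of_abs_lt_dvd h2 (by rw [abs_lt]; omega)
  omega

lemma sum_sum_wrap_le (n : ℕ) (m : ℤ) :
    ∑ i ∈ Finset.range n, ∑ j ∈ Finset.range n, wrap n (i - j) m ≤ n := by
  refine (Finset.sum_le_sum fun i _ => sum_wrap_le_one n i m).trans ?_
  simp

lemma sum_sum_wrap_le_natAbs (n : ℕ) (m : ℤ) :
    ∑ i ∈ Finset.range n, ∑ j ∈ Finset.range n, wrap n (i - j) m ≤ m.natAbs := by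
  have h : ∀ i ∈ Finset.range n, ∑ j ∈ Finset.range n, wrap n (i - j) m ≤
      if (i : ℤ) - m < 0 ∨ n ≤ i - m then 1 else 0 := by
    intro i _
    split_ifs with h
    · exact sum_wrap_le_one n i m
    · push Not at h
      exact (sum_wrap_eq_zero h.1 h.2).le
  refine (Finset.sum_le_sum h).trans ?_
  rw [← Finset.sum_filter, Finset.sum_const, nsmul_one, Nat.cast_le]
  rcases le_total 0 m with hm | hm
  · refine (Finset.card_le_card (t := Finset.range m.natAbs) fun i hi => ?_).trans_eq
      (Finset.card_range _)
    simp only [Finset.mem_filter, Finset.mem_range] at hi ⊢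
    omega
  · refine (Finset.card_le_card (t := Finset.Ico (n - m.natAbs) n) fun i hi => ?_).trans ?_
    · simp only [Finset.mem_filter, Finset.mem_range, Finset.mem_Ico] at hi ⊢
      omega
    · rw [Nat.card_Ico]; omega

variable {K : ℤ → ℝ}

lemma sum_abs_toeplitz_sub_circMatrix_le (hev : ∀ m, K (-m) = K m)
    (hK : Summable fun m : ℤ => |K m|) (n : ℕ) :
    ∑ i, ∑ j, |(toeplitz K n - circMatrix (spectrum' K) n) i j| ≤
      ∑' m, |K m| * ∑ i ∈ Finset.range n, ∑ j ∈ Finset.range n, wrap n (i - j) m := by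
  have h1 : HasSum (fun m => |K m| * ∑ i ∈ Finset.range n, ∑ j ∈ Finset.range n, wrap n (i - j) m)
      (∑ i ∈ Finset.range n, ∑ j ∈ Finset.range n, ∑' m, |K m| * wrap n (i - j) m) := by
    simp only [Finset.mul_sum]
    exact hasSum_sum fun i _ => hasSum_sum fun j _ => (summable_mul_wrap hK n (i - j)).hasSum
  rw [h1.tsum_eq, ← Fin.sum_univ_eq_sum_range
    (fun i => ∑ j ∈ Finset.range n, ∑' m, |K m| * wrap n (i - j) m)]
  refine Finset.sum_le_sum fun i _ => ?_
  rw [← Fin.sum_univ_eq_sum_range (fun j => ∑' m, |K m| * wrap n (i - j) m)]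
  refine Finset.sum_le_sum fun j _ => ?_
  rw [Matrix.sub_apply, abs_sub_comm]
  exact abs_circ_sub_le hev hK i.pos i j

lemma tendsto_sum_abs_toeplitz_sub_circMatrix (hev : ∀ m, K (-m) = K m)
    (hK : Summable fun m : ℤ => |K m|) :
    Tendsto (fun n : ℕ => (∑ i, ∑ j, |(toeplitz K n - circMatrix (spectrum' K) n) i j|) / (n : ℝ))
      atTop (nhds 0) := by
  set W : ℕ → ℤ → ℝ := fun n m => ∑ i ∈ Finset.range n, ∑ j ∈ Finset.range n, wrap n (i - j) m
    with hW
  have hW0 : ∀ n m, 0 ≤ W n m := fun n m =>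
    Finset.sum_nonneg fun _ _ => Finset.sum_nonneg fun _ _ => wrap_nonneg _ _ _
  have h : Tendsto (fun n : ℕ => ∑' m, |K m| * (W n m / n)) atTop (nhds 0) := by
    have := tendsto_tsum_of_dominated_convergence (𝓕 := atTop)
      (f := fun (n : ℕ) m => |K m| * (W n m / n)) (g := fun _ => 0) hK ?_ ?_
    · simpa using this
    · intro m
      have h1 : Tendsto (fun n : ℕ => W n m / n) atTop (nhds 0) :=
        squeeze_zero (fun n => div_nonneg (hW0 n m) n.cast_nonneg)
          (fun n => div_le_div_of_nonneg_right (sum_sum_wrap_le_natAbs n m) n.cast_nonneg)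
          (tendsto_const_div_atTop_nhds_zero_nat _)
      simpa using h1.const_mul |K m|
    · refine Eventually.of_forall fun n m => ?_
      rw [norm_mul, Real.norm_eq_abs, abs_abs, Real.norm_eq_abs,
        abs_of_nonneg (div_nonneg (hW0 n m) n.cast_nonneg)]
      exact mul_le_of_le_one_right (abs_nonneg _)
        (div_le_one_of_le₀ (sum_sum_wrap_le n m) n.cast_nonneg)
  refine squeeze_zero (fun n => by positivity) (fun n => ?_) h
  simp only [← mul_div_assoc]
  rw [tsum_div_const]
  exact div_le_div_of_nonneg_right (sum_abs_toeplitz_sub_circMatrix_le hev hK n) n.cast_nonneg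

theorem tendsto_gaussianDivergence_toeplitz {Kp Kq : ℤ → ℝ}
    (hKp_even : ∀ m, Kp (-m) = Kp m) (hKq_even : ∀ m, Kq (-m) = Kq m)
    (hKp_sum : Summable fun m : ℤ => |Kp m|) (hKq_sum : Summable fun m : ℤ => |Kq m|)
    {c M : ℝ} (hc : 0 < c) (hcM : c ≤ M)
    (hSp : ∀ f ∈ Set.Icc (0 : ℝ) 1, c ≤ spectrum' Kp f ∧ spectrum' Kp f ≤ M)
    (hSq : ∀ f ∈ Set.Icc (0 : ℝ) 1, c ≤ spectrum' Kq f) :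
    Tendsto (fun n : ℕ => gaussianDivergence (toeplitz Kp n) (toeplitz Kq n) / n) atTop
      (nhds (∫ f in (0 : ℝ)..1,
        (spectrum' Kp f / spectrum' Kq f - Real.log (spectrum' Kp f / spectrum' Kq f) - 1))) := by
  set Sp := spectrum' Kp with hSpdef
  set Sq := spectrum' Kq with hSqdef
  have p0 : ∀ f ∈ Set.Icc (0 : ℝ) 1, Sp f ≠ 0 := fun f hf => (hc.trans_le (hSp f hf).1).ne'
  have q0 : ∀ f ∈ Set.Icc (0 : ℝ) 1, Sq f ≠ 0 := fun f hf => (hc.trans_le (hSq f hf)).ne'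
  have hdivc : ContinuousOn (fun f => Sp f / Sq f) (Set.Icc 0 1) :=
    (continuous_spectrum' hKp_sum).continuousOn.div (continuous_spectrum' hKq_sum).continuousOn q0
  have hcont : ContinuousOn (fun f => Sp f / Sq f - Real.log (Sp f / Sq f) - 1) (Set.Icc 0 1) :=
    (hdivc.sub (hdivc.log fun f hf => div_ne_zero (p0 f hf) (q0 f hf))).sub continuousOn_const
  have h1 := tendsto_riemann_sum hcont
  have h2 : Tendsto (fun n : ℕ => gaussianDivergence (toeplitz Kp n) (toeplitz Kq n) / n -
      (∑ k ∈ Finset.range n,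
        (Sp (k / n) / Sq (k / n) - Real.log (Sp (k / n) / Sq (k / n)) - 1)) / n)
      atTop (nhds 0) := by
    have h3 := ((tendsto_sum_abs_toeplitz_sub_circMatrix hKp_even hKp_sum).const_mul (2 / c)).add
      ((tendsto_sum_abs_toeplitz_sub_circMatrix hKq_even hKq_sum).const_mul (M / c ^ 2 + 1 / c))
    rw [mul_zero, mul_zero, add_zero] at h3
    refine squeeze_zero_norm (fun n => ?_) h3
    have h4 : ∑ k ∈ Finset.range n,
        (Sp (k / n) / Sq (k / n) - Real.log (Sp (k / n) / Sq (k / n)) - 1) =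
        gaussianDivergence (circMatrix Sp n) (circMatrix Sq n) := by
      rw [circMatrix_eq, circMatrix_eq, gaussianDivergence_of_diagonal (hartleyMatrix_mul_self n)
        (fun k => hc.trans_le (hSp _ (div_mem_unitInterval_of_lt k.2)).1)
        (fun k => hc.trans_le (hSq _ (div_mem_unitInterval_of_lt k.2))),
        ← Fin.sum_univ_eq_sum_range (fun k : ℕ =>
          Sp (k / n) / Sq (k / n) - Real.log (Sp (k / n) / Sq (k / n)) - 1)]
    rw [h4, ← sub_div, Real.norm_eq_abs, abs_div, Nat.abs_cast, ← mul_div_assoc, ← mul_div_assoc,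
      ← add_div]
    refine div_le_div_of_nonneg_right ?_ n.cast_nonneg
    refine abs_gaussianDivergence_sub_le (transpose_toeplitz hKp_even n)
      (transpose_toeplitz hKq_even n) (transpose_circMatrix _ n) (transpose_circMatrix _ n) hc
      (hc.le.trans hcM) (le_toeplitz_form hKp_even hKp_sum fun f hf => (hSp f hf).1)
      (le_toeplitz_form hKq_even hKq_sum hSq) (fun x => ?_) (fun x => ?_)
      (toeplitz_form_le hKp_even hKp_sum fun f hf => (hSp f hf).2)
    · rw [circMatrix_form]
      exact le_circ_form le_rfl (fun f hf => (hSp f hf).1) x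
    · rw [circMatrix_form]
      exact le_circ_form le_rfl hSq x
  simpa using h2.add h1

end Asymptotics

section GaussianMeasure

open ProbabilityTheory

lemma pi_gaussianReal_eq_withDensity (n : ℕ) :
    Measure.pi (fun _ : Fin n => gaussianReal 0 1) =
      volume.withDensity fun z => ENNReal.ofReal (∏ i, gaussianPDFReal 0 1 (z i)) := by
  refine Measure.pi_eq fun s hs => ?_
  have hnn : ∀ z : Fin n → ℝ, 0 ≤ ∏ i, gaussianPDFReal 0 1 (z i) := fun z =>
    Finset.prod_nonneg fun i _ => gaussianPDFReal_nonneg _ _ _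
  have hint : ∀ i, Integrable (gaussianPDFReal 0 1) (volume.restrict (s i)) := fun i =>
    (integrable_gaussianPDFReal 0 1).restrict
  rw [withDensity_apply _ (MeasurableSet.univ_pi hs), volume_pi, Measure.restrict_pi_pi,
    ← ofReal_integral_eq_lintegral_ofReal (Integrable.fintype_prod hint)
      (Eventually.of_forall hnn),
    integral_fintype_prod_eq_prod (fun _ => gaussianPDFReal 0 1),
    ENNReal.ofReal_prod_of_nonneg fun i _ => integral_nonneg fun x => gaussianPDFReal_nonneg _ _ _]
  refine Finset.prod_congr rfl fun i _ => ?_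
  rw [gaussianReal_apply_eq_integral _ one_ne_zero]

lemma prod_gaussianPDFReal (n : ℕ) (z : Fin n → ℝ) :
    ∏ i, gaussianPDFReal 0 1 (z i) =
      (Real.sqrt ((2 * Real.pi) ^ n))⁻¹ * Real.exp (-(z ⬝ᵥ z) / 2) := by
  simp only [gaussianPDFReal, NNReal.coe_one, mul_one, sub_zero]
  rw [Finset.prod_mul_distrib, Finset.prod_const, Finset.card_univ, Fintype.card_fin,
    ← Real.exp_sum, inv_pow, Real.sqrt_eq_rpow, Real.sqrt_eq_rpow, ← Real.rpow_natCast,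
    ← Real.rpow_natCast, ← Real.rpow_mul (by positivity), ← Real.rpow_mul (by positivity),
    mul_comm (1 / 2 : ℝ), ← Finset.sum_div, Finset.sum_neg_distrib]
  simp only [dotProduct, sq]

lemma continuous_gaussianPdf (n : ℕ) (P : Matrix (Fin n) (Fin n) ℝ) :
    Continuous (gaussianPdf n P) := by
  unfold gaussianPdf dotProduct mulVec dotProduct
  fun_prop

lemma dotProduct_inv_mulVec_of_eq {n : ℕ} {P T : Matrix (Fin n) (Fin n) ℝ} (hT : IsUnit T.det)
    (hP : P = T * Tᵀ) (z : Fin n → ℝ) : (T *ᵥ z) ⬝ᵥ (P⁻¹ *ᵥ (T *ᵥ z)) = z ⬝ᵥ z := by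
  have hT' : IsUnit Tᵀ.det := by rwa [det_transpose]
  have : Tᵀ * (P⁻¹ * T) = 1 := by
    rw [hP, Matrix.mul_inv_rev, Matrix.mul_assoc, nonsing_inv_mul _ hT, Matrix.mul_one,
      mul_nonsing_inv _ hT']
  rw [mulVec_mulVec, ← vecMul_transpose, ← dotProduct_mulVec, mulVec_mulVec, this, one_mulVec]

lemma gaussianMeasure_eq_map {n : ℕ} {P T : Matrix (Fin n) (Fin n) ℝ} (hT : IsUnit T.det)
    (hP : P = T * Tᵀ) :
    gaussianMeasure n P =
      (Measure.pi (fun _ : Fin n => gaussianReal 0 1)).map (fun z => T *ᵥ z) := by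
  have hmeas : Measurable (fun z : Fin n → ℝ => T *ᵥ z) :=
    (Continuous.matrix_mulVec continuous_const continuous_id).measurable
  have h0 : T.det ≠ 0 := hT.ne_zero
  have hvol : (volume : Measure (Fin n → ℝ)) =
      ENNReal.ofReal |T.det| • volume.map (fun z => T *ᵥ z) := by
    have := Real.map_matrix_volume_pi_eq_smul_volume_pi h0
    have e : (⇑(toLin' T) : (Fin n → ℝ) → Fin n → ℝ) = fun z => T *ᵥ z := by
      ext z; simp
    rw [e] at this
    rw [this, smul_smul, ← ENNReal.ofReal_mul (abs_nonneg _), ← abs_mul, mul_inv_cancel₀ h0,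
      abs_one, ENNReal.ofReal_one, one_smul]
  ext B hB
  rw [Measure.map_apply hmeas hB, pi_gaussianReal_eq_withDensity, gaussianMeasure,
    withDensity_apply _ hB, withDensity_apply _ (hmeas hB)]
  have hm : Measurable fun x => ENNReal.ofReal (gaussianPdf n P x) :=
    (continuous_gaussianPdf n P).measurable.ennreal_ofReal
  have hm' : Measurable fun z => ENNReal.ofReal (gaussianPdf n P (T *ᵥ z)) := hm.comp hmeas
  conv_lhs => rw [hvol]
  rw [Measure.restrict_smul, lintegral_smul_measure, setLIntegral_map hB hm hmeas, smul_eq_mul,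
    ← lintegral_const_mul _ hm']
  refine lintegral_congr fun z => ?_
  rw [← ENNReal.ofReal_mul (abs_nonneg _), prod_gaussianPDFReal, gaussianPdf,
    dotProduct_inv_mulVec_of_eq hT hP]
  congr 1
  have hdet : P.det = T.det ^ 2 := by rw [hP, det_mul, det_transpose, sq]
  have h1 : |T.det| ≠ 0 := abs_ne_zero.2 h0
  rw [hdet, Real.sqrt_mul (by positivity), Real.sqrt_sq_eq_abs, mul_inv]
  field_simp

/-- The log-likelihood ratio of the centered Gaussians with covariances `P` and `Q`. -/
noncomputable def gaussianLogRatio {n : ℕ} (P Q : Matrix (Fin n) (Fin n) ℝ) (x : Fin n → ℝ) : ℝ :=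
  (Real.log Q.det - Real.log P.det) / 2 + (x ⬝ᵥ (Q⁻¹ *ᵥ x) - x ⬝ᵥ (P⁻¹ *ᵥ x)) / 2

lemma continuous_gaussianLogRatio {n : ℕ} (P Q : Matrix (Fin n) (Fin n) ℝ) :
    Continuous (gaussianLogRatio P Q) := by
  unfold gaussianLogRatio dotProduct mulVec dotProduct
  fun_prop

lemma gaussianPdf_eq_exp_mul {n : ℕ} {P Q : Matrix (Fin n) (Fin n) ℝ} (hP : 0 < P.det)
    (hQ : 0 < Q.det) (x : Fin n → ℝ) :
    gaussianPdf n P x = Real.exp (gaussianLogRatio P Q x) * gaussianPdf n Q x := by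
  have h : ∀ {a : ℝ}, 0 < a → (√((2 * Real.pi) ^ n * a))⁻¹ =
      (√((2 * Real.pi) ^ n))⁻¹ * Real.exp (-(Real.log a / 2)) := by
    intro a ha
    rw [Real.sqrt_mul (by positivity), mul_inv, Real.exp_neg, ← Real.log_sqrt ha.le,
      Real.exp_log (Real.sqrt_pos.2 ha)]
  rw [gaussianPdf, gaussianPdf, h hP, h hQ, mul_assoc, ← Real.exp_add, mul_assoc, ← Real.exp_add,
    mul_left_comm, ← Real.exp_add, gaussianLogRatio]
  ring_nf

lemma gaussianPdf_nonneg {n : ℕ} (P : Matrix (Fin n) (Fin n) ℝ) (x : Fin n → ℝ) :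
    0 ≤ gaussianPdf n P x := by
  unfold gaussianPdf; positivity

lemma gaussianLogRatio_mulVec {n : ℕ} {P Q T : Matrix (Fin n) (Fin n) ℝ} {d : Fin n → ℝ}
    (hT : IsUnit T.det) (hP : P = T * Tᵀ)
    (hd : Tᵀ * Q⁻¹ * T = diagonal d) (z : Fin n → ℝ) :
    gaussianLogRatio P Q (T *ᵥ z) - gaussianDivergence P Q / 2 =
      ∑ i, (d i - 1) / 2 * z i ^ 2 - ∑ i, (d i - 1) / 2 := by
  have h1 : (T *ᵥ z) ⬝ᵥ (Q⁻¹ *ᵥ (T *ᵥ z)) = ∑ i, d i * z i ^ 2 := by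
    rw [mulVec_mulVec, ← vecMul_transpose, ← dotProduct_mulVec, mulVec_mulVec, ← Matrix.mul_assoc,
      hd, dotProduct]
    exact Finset.sum_congr rfl fun i _ => by rw [mulVec_diagonal]; ring
  rw [gaussianLogRatio, h1, dotProduct_inv_mulVec_of_eq hT hP, gaussianDivergence,
    trace_inv_mul_of_simultaneous hP hd, Fintype.card, Finset.cast_card]
  have h2 : ∑ i, (d i - 1) / 2 * z i ^ 2 = (∑ i, d i * z i ^ 2 - z ⬝ᵥ z) / 2 := by
    rw [dotProduct, ← Finset.sum_sub_distrib, Finset.sum_div]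
    exact Finset.sum_congr rfl fun i _ => by ring
  rw [h2, ← Finset.sum_div, Finset.sum_sub_distrib]
  ring

lemma integral_sq_gaussianReal : ∫ x, x ^ 2 ∂(gaussianReal 0 1) = 1 := by
  have h := variance_fun_id_gaussianReal (μ := 0) (v := 1)
  rw [variance_of_integral_eq_zero (by fun_prop) (by simp)] at h
  simpa using h

lemma memLp_sq_gaussianReal : MemLp (fun x : ℝ => x ^ 2) 2 (gaussianReal 0 1) := by
  have h := (memLp_id_gaussianReal' (μ := 0) (v := 1) 4 (by simp)).norm_rpow_div (2 : ENNReal)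
  have e : (4 : ENNReal) / 2 = 2 := by
    rw [show (4 : ENNReal) = 2 * 2 by norm_num, ENNReal.mul_div_cancel_right (by simp) (by simp)]
  rw [e] at h
  simpa using h

/-- Weighted sums of squares of independent standard Gaussians concentrate. -/
lemma measure_weighted_chiSq_deviation_le {n : ℕ} {a : Fin n → ℝ} {b : ℝ} (hab : ∀ i, |a i| ≤ b)
    {t : ℝ} (ht : 0 < t) :
    Measure.pi (fun _ : Fin n => gaussianReal 0 1)
        {z | t ≤ |∑ i, a i * z i ^ 2 - ∑ i, a i|} ≤
      ENNReal.ofReal (n * (b ^ 2 * Var[fun x => x ^ 2; gaussianReal 0 1]) / t ^ 2) := by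
  set X : Fin n → ℝ → ℝ := fun i x => a i * x ^ 2 with hX
  have hmem : ∀ i, MemLp (X i) 2 (gaussianReal 0 1) := fun i => memLp_sq_gaussianReal.const_mul _
  have hmem' : ∀ i, MemLp (fun z : Fin n → ℝ => X i (z i)) 2
      (Measure.pi (fun _ : Fin n => gaussianReal 0 1)) := fun i =>
    (hmem i).comp_measurePreserving
      (measurePreserving_eval (fun _ : Fin n => gaussianReal 0 1) i)
  have hvar := variance_sum_pi (μ := fun _ : Fin n => gaussianReal 0 1) hmem
  have hmean : ∫ z, (∑ i, fun z : Fin n → ℝ => X i (z i)) z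
      ∂(Measure.pi (fun _ : Fin n => gaussianReal 0 1)) = ∑ i, a i := by
    simp only [Finset.sum_apply]
    rw [integral_finsetSum _ fun i _ => (hmem' i).integrable (by norm_num)]
    refine Finset.sum_congr rfl fun i _ => ?_
    rw [integral_comp_eval (hmem i).aestronglyMeasurable, integral_const_mul,
      integral_sq_gaussianReal, mul_one]
  have hch := meas_ge_le_variance_div_sq (memLp_finsetSum' Finset.univ fun i _ => hmem' i) ht
  rw [hmean, hvar] at hch
  simp only [Finset.sum_apply] at hch
  refine hch.trans (ENNReal.ofReal_le_ofReal ?_)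
  gcongr
  have : ∀ i ∈ Finset.univ, Var[X i; gaussianReal 0 1] ≤
      b ^ 2 * Var[fun x => x ^ 2; gaussianReal 0 1] := by
    intro i _
    rw [hX, variance_const_mul]
    exact mul_le_mul_of_nonneg_right (sq_le_sq' (abs_le.1 (hab i)).1 (abs_le.1 (hab i)).2)
      (variance_nonneg _ _)
  refine (Finset.sum_le_sum this).trans_eq ?_
  simp

lemma gaussianMeasure_logRatio_deviation_le {n : ℕ} {P Q : Matrix (Fin n) (Fin n) ℝ}
    (sP : Pᵀ = P) (sQ : Qᵀ = Q) {c M : ℝ} (hc : 0 < c) (hcM : c ≤ M)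
    (lP : ∀ x, c * (x ⬝ᵥ x) ≤ x ⬝ᵥ (P *ᵥ x)) (lQ : ∀ x, c * (x ⬝ᵥ x) ≤ x ⬝ᵥ (Q *ᵥ x))
    (uP : ∀ x, x ⬝ᵥ (P *ᵥ x) ≤ M * (x ⬝ᵥ x)) {t : ℝ} (ht : 0 < t) :
    gaussianMeasure n P {x | t ≤ |gaussianLogRatio P Q x - gaussianDivergence P Q / 2|} ≤
      ENNReal.ofReal
        (n * ((M / c) ^ 2 * Var[fun x => x ^ 2; gaussianReal 0 1]) / t ^ 2) := by
  have hP := posDef_of_form_lower_bound sP hc lP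
  have hQ := posDef_of_form_lower_bound sQ hc lQ
  obtain ⟨T, d, hT, hPT, hd, hpos⟩ := posDef_simultaneous_diagonalization hP hQ
  have hle := simultaneous_diagonal_le hQ.det_pos.ne'.isUnit hPT hd hc (hc.le.trans hcM) lQ uP
  have hmeas : Measurable (fun z : Fin n → ℝ => T *ᵥ z) :=
    (Continuous.matrix_mulVec continuous_const continuous_id).measurable
  rw [gaussianMeasure_eq_map hT hPT, Measure.map_apply hmeas]
  · simp only [Set.preimage_ofPred_eq, gaussianLogRatio_mulVec hT hPT hd]
    refine measure_weighted_chiSq_deviation_le (fun i => ?_) ht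
    have h1 : 1 ≤ M / c := (one_le_div hc).2 hcM
    rw [abs_le]
    constructor <;> linarith [hpos i, hle i]
  · exact measurableSet_le measurable_const
      (((continuous_gaussianLogRatio P Q).sub continuous_const).abs).measurable

lemma isProbabilityMeasure_gaussianMeasure {n : ℕ} {P : Matrix (Fin n) (Fin n) ℝ}
    (hP : P.PosDef) : IsProbabilityMeasure (gaussianMeasure n P) := by
  obtain ⟨R, hR, hPR⟩ := posDef_exists_mul_transpose hP
  rw [gaussianMeasure_eq_map hR hPR]
  exact Measure.isProbabilityMeasure_map
    (Continuous.matrix_mulVec continuous_const continuous_id).measurable.aemeasurable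

lemma gaussianMeasure_le_exp_mul {n : ℕ} {P Q : Matrix (Fin n) (Fin n) ℝ} (hP : 0 < P.det)
    (hQ : 0 < Q.det) {a : ℝ} {B : Set (Fin n → ℝ)} (hB : MeasurableSet B)
    (h : ∀ x ∈ B, a ≤ gaussianLogRatio P Q x) :
    gaussianMeasure n Q B ≤ ENNReal.ofReal (Real.exp (-a)) * gaussianMeasure n P B := by
  have hm : Measurable fun x => ENNReal.ofReal (gaussianPdf n P x) :=
    (continuous_gaussianPdf n P).measurable.ennreal_ofReal
  rw [gaussianMeasure, gaussianMeasure, withDensity_apply _ hB, withDensity_apply _ hB,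
    ← lintegral_const_mul _ hm]
  refine setLIntegral_mono (hm.const_mul _) fun x hx => ?_
  rw [← ENNReal.ofReal_mul (Real.exp_pos _).le, gaussianPdf_eq_exp_mul hP hQ, ← mul_assoc,
    ← Real.exp_add]
  refine ENNReal.ofReal_le_ofReal (le_mul_of_one_le_left (gaussianPdf_nonneg Q x) ?_)
  exact Real.one_le_exp (by linarith [h x hx])

lemma exp_mul_gaussianMeasure_le {n : ℕ} {P Q : Matrix (Fin n) (Fin n) ℝ} (hP : 0 < P.det)
    (hQ : 0 < Q.det) {b : ℝ} {B : Set (Fin n → ℝ)} (hB : MeasurableSet B)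
    (h : ∀ x ∈ B, gaussianLogRatio P Q x ≤ b) :
    ENNReal.ofReal (Real.exp (-b)) * gaussianMeasure n P B ≤ gaussianMeasure n Q B := by
  have hm : ∀ R, Measurable fun x => ENNReal.ofReal (gaussianPdf n R x) := fun R =>
    (continuous_gaussianPdf n R).measurable.ennreal_ofReal
  rw [gaussianMeasure, gaussianMeasure, withDensity_apply _ hB, withDensity_apply _ hB,
    ← lintegral_const_mul _ (hm P)]
  refine setLIntegral_mono (hm Q) fun x hx => ?_
  rw [← ENNReal.ofReal_mul (Real.exp_pos _).le, gaussianPdf_eq_exp_mul hP hQ, ← mul_assoc,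
    ← Real.exp_add]
  refine ENNReal.ofReal_le_ofReal (mul_le_of_le_one_left (gaussianPdf_nonneg Q x) ?_)
  exact Real.exp_le_one_iff.2 (by linarith [h x hx])

end GaussianMeasure

section Stein

variable {X : Type*} [MeasurableSpace X] {p q : Measure X}

/-- Stein lemma, achievability: if `p ≥ e^a q` on a set of large `p`-mass, then the minimal
type-II error is at most `e^{-a}`. -/
lemma minTypeIIError_le [IsProbabilityMeasure p] {G : Set X} (hG : MeasurableSet G) {a τ : ℝ}
    (h : ∀ B, MeasurableSet B → B ⊆ G → q B ≤ ENNReal.ofReal (Real.exp (-a)) * p B)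
    (hp : p Gᶜ < ENNReal.ofReal τ) :
    minTypeIIError p q τ ≤ ENNReal.ofReal (Real.exp (-a)) := by
  have hβ : minTypeIIError p q τ ≤ q G := sInf_le ⟨G, hG, hp, rfl⟩
  refine hβ.trans ((h G hG subset_rfl).trans ?_)
  exact mul_le_of_le_one_right' prob_le_one

/-- Stein lemma, converse: if `p ≤ e^b q` on a set of large `p`-mass, then the minimal type-II
error is at least a constant multiple of `e^{-b}`. -/
lemma le_minTypeIIError [IsProbabilityMeasure p] {G : Set X} (hG : MeasurableSet G) {b τ δ : ℝ}
    (hτ : 0 ≤ τ) (hδ : 0 ≤ δ)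
    (h : ∀ B, MeasurableSet B → B ⊆ G → ENNReal.ofReal (Real.exp (-b)) * p B ≤ q B)
    (hp : p Gᶜ ≤ ENNReal.ofReal δ) :
    ENNReal.ofReal (Real.exp (-b) * (1 - τ - δ)) ≤ minTypeIIError p q τ := by
  refine le_sInf ?_
  rintro _ ⟨B, hB, hpB, rfl⟩
  have h1 : ENNReal.ofReal (1 - τ - δ) ≤ p (B ∩ G) := by
    have h2 : p (B ∩ G)ᶜ ≤ ENNReal.ofReal (τ + δ) := by
      rw [Set.compl_inter, ENNReal.ofReal_add hτ hδ]
      exact (measure_union_le _ _).trans (add_le_add hpB.le hp)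
    have h3 := prob_compl_eq_one_sub (μ := p) (hB.inter hG).compl
    rw [compl_compl] at h3
    rw [h3, sub_sub, ENNReal.ofReal_sub _ (add_nonneg hτ hδ), ENNReal.ofReal_one]
    exact tsub_le_tsub_left h2 1
  rw [ENNReal.ofReal_mul (Real.exp_pos _).le]
  calc _ ≤ ENNReal.ofReal (Real.exp (-b)) * p (B ∩ G) := by gcongr
    _ ≤ q (B ∩ G) := h _ (hB.inter hG) Set.inter_subset_right
    _ ≤ q B := measure_mono Set.inter_subset_left

/-- The minimal type-II error has exponent half the divergence, up to any deviation `t` that the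
log-likelihood ratio exceeds with small probability. -/
lemma abs_neg_log_minTypeIIError_sub_le {n : ℕ} {P Q : Matrix (Fin n) (Fin n) ℝ}
    (hP : P.PosDef) (hQ : Q.PosDef) {t τ : ℝ} (hτ0 : 0 < τ) (hτ1 : τ < 1 / 2)
    (h1 : gaussianMeasure n P {x | t ≤ |gaussianLogRatio P Q x - gaussianDivergence P Q / 2|} <
      ENNReal.ofReal τ)
    (h2 : gaussianMeasure n P {x | t ≤ |gaussianLogRatio P Q x - gaussianDivergence P Q / 2|} ≤
      ENNReal.ofReal (1 / 4)) :
    |-Real.log (minTypeIIError (gaussianMeasure n P) (gaussianMeasure n Q) τ).toReal -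
      gaussianDivergence P Q / 2| ≤ t + Real.log 4 := by
  have := isProbabilityMeasure_gaussianMeasure hP
  set D := gaussianDivergence P Q / 2
  set β := minTypeIIError (gaussianMeasure n P) (gaussianMeasure n Q) τ
  set G : Set (Fin n → ℝ) := {x | t ≤ |gaussianLogRatio P Q x - D|}ᶜ with hG
  have hGm : MeasurableSet G := (measurableSet_le measurable_const
    (((continuous_gaussianLogRatio P Q).sub continuous_const).abs).measurable).compl
  have hlt : ∀ x ∈ G, |gaussianLogRatio P Q x - D| < t := fun x hx => not_le.1 hx
  have hup : β ≤ ENNReal.ofReal (Real.exp (-(D - t))) := by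
    refine minTypeIIError_le hGm (fun B hB hBG => ?_) (by rwa [hG, compl_compl])
    exact gaussianMeasure_le_exp_mul hP.det_pos hQ.det_pos hB fun x hx => by
      linarith [(abs_lt.1 (hlt x (hBG hx))).1]
  have hlow : ENNReal.ofReal (Real.exp (-(D + t)) * (1 - τ - 1 / 4)) ≤ β := by
    refine le_minTypeIIError hGm hτ0.le (by norm_num) (fun B hB hBG => ?_)
      (by rwa [hG, compl_compl])
    exact exp_mul_gaussianMeasure_le hP.det_pos hQ.det_pos hB fun x hx => by
      linarith [(abs_lt.1 (hlt x (hBG hx))).2]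
  have hβ : β ≠ ⊤ := ne_top_of_le_ne_top ENNReal.ofReal_ne_top hup
  have hup' : β.toReal ≤ Real.exp (-(D - t)) :=
    ENNReal.toReal_le_of_le_ofReal (Real.exp_pos _).le hup
  have hlow' : Real.exp (-(D + t)) * (1 / 4) ≤ β.toReal :=
    (mul_le_mul_of_nonneg_left (by linarith) (Real.exp_pos _).le).trans
      ((ENNReal.ofReal_le_iff_le_toReal hβ).1 hlow)
  have hpos : 0 < β.toReal := lt_of_lt_of_le (by positivity) hlow'
  have l1 := Real.log_le_log hpos hup'
  have l2 := Real.log_le_log (by positivity) hlow'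
  rw [Real.log_exp] at l1
  rw [Real.log_mul (Real.exp_pos _).ne' (by norm_num), Real.log_exp, one_div, Real.log_inv] at l2
  have l3 : 0 ≤ Real.log 4 := Real.log_nonneg (by norm_num)
  rw [abs_le]
  constructor <;> linarith

end Stein

/-- **Stein exponent for correlated Gaussian hypothesis testing.** Let `K_p`, `K_q` be even,
absolutely summable auto-covariances whose spectra are bounded between `0 < c` and `M` on
`[0,1]`, let `p⁽ⁿ⁾ = N(0, Λ_p⁽ⁿ⁾)`, `q⁽ⁿ⁾ = N(0, Λ_q⁽ⁿ⁾)` with Toeplitz covariances, fix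
`0 < τ < 1/2`, and let `β_{τ,n}` be the minimal type-II error. Then
`(-ln β_{τ,n}) / n → C_s = (1/2) ∫₀¹ (S_p/S_q - ln (S_p/S_q) - 1) df`. -/
theorem stein_exponent_correlated_gaussian
    (Kp Kq : ℤ → ℝ)
    (hKp_even : ∀ m, Kp (-m) = Kp m) (hKq_even : ∀ m, Kq (-m) = Kq m)
    (hKp_sum : Summable fun m : ℤ => |Kp m|) (hKq_sum : Summable fun m : ℤ => |Kq m|)
    (c M : ℝ) (hc : 0 < c) (hcM : c ≤ M)
    (hSp : ∀ f ∈ Set.Icc (0 : ℝ) 1, c ≤ spectrum' Kp f ∧ spectrum' Kp f ≤ M)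
    (hSq : ∀ f ∈ Set.Icc (0 : ℝ) 1, c ≤ spectrum' Kq f ∧ spectrum' Kq f ≤ M)
    (τ : ℝ) (hτ0 : 0 < τ) (hτ1 : τ < 1/2) :
    Tendsto (fun n : ℕ =>
        (-Real.log ((minTypeIIError (gaussianMeasure n (toeplitz Kp n))
            (gaussianMeasure n (toeplitz Kq n)) τ).toReal)) / (n : ℝ))
      atTop
      (nhds ((1 / 2) * ∫ f in (0 : ℝ)..1,
        (spectrum' Kp f / spectrum' Kq f - Real.log (spectrum' Kp f / spectrum' Kq f) - 1))) := by
  have sP := transpose_toeplitz hKp_even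
  have sQ := transpose_toeplitz hKq_even
  have lP : ∀ n x, _ := fun n =>
    le_toeplitz_form hKp_even hKp_sum (fun f hf => (hSp f hf).1) (n := n)
  have lQ : ∀ n x, _ := fun n =>
    le_toeplitz_form hKq_even hKq_sum (fun f hf => (hSq f hf).1) (n := n)
  have uP : ∀ n x, _ := fun n =>
    toeplitz_form_le hKp_even hKp_sum (fun f hf => (hSp f hf).2) (n := n)
  have hP : ∀ n, (toeplitz Kp n).PosDef := fun n => posDef_of_form_lower_bound (sP n) hc (lP n)
  have hQ : ∀ n, (toeplitz Kq n).PosDef := fun n => posDef_of_form_lower_bound (sQ n) hc (lQ n)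
  have hdiv := (tendsto_gaussianDivergence_toeplitz hKp_even hKq_even hKp_sum hKq_sum hc hcM hSp
    fun f hf => (hSq f hf).1).const_mul (1 / 2)
  refine hdiv.congr_dist ?_
  rw [Metric.tendsto_atTop']
  intro ε hε
  set V := (M / c) ^ 2 * ProbabilityTheory.variance (fun x : ℝ => x ^ 2)
    (ProbabilityTheory.gaussianReal 0 1)
  have e1 : ∀ᶠ n : ℕ in atTop, V / (ε / 2) ^ 2 / n < min τ (1 / 4) :=
    (tendsto_const_div_atTop_nhds_zero_nat _).eventually_lt_const (by positivity)
  have e2 : ∀ᶠ n : ℕ in atTop, Real.log 4 / n < ε / 2 :=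
    (tendsto_const_div_atTop_nhds_zero_nat _).eventually_lt_const (by positivity)
  obtain ⟨N, hN⟩ := eventually_atTop.1 (e1.and e2)
  refine ⟨N, fun n hn => ?_⟩
  obtain ⟨h1, h2⟩ := hN n hn.le
  have hn0 : (0 : ℝ) < n := by exact_mod_cast (Nat.zero_le N).trans_lt hn
  have hdev := gaussianMeasure_logRatio_deviation_le (sP n) (sQ n) hc hcM (lP n) (lQ n) (uP n)
    (mul_pos (half_pos hε) hn0)
  have hV : n * V / (ε / 2 * n) ^ 2 = V / (ε / 2) ^ 2 / n := by field_simp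
  rw [hV] at hdev
  have key := abs_neg_log_minTypeIIError_sub_le (hP n) (hQ n) hτ0 hτ1
    (hdev.trans_lt ((ENNReal.ofReal_lt_ofReal_iff hτ0).2 (h1.trans_le (min_le_left _ _))))
    (hdev.trans (ENNReal.ofReal_le_ofReal (h1.le.trans (min_le_right _ _))))
  rw [Real.dist_0_eq_abs, abs_of_nonneg dist_nonneg, dist_comm, Real.dist_eq, ← mul_div_assoc,
    ← sub_div, abs_div, abs_of_pos hn0, one_div_mul_eq_div]
  calc _ ≤ (ε / 2 * n + Real.log 4) / n := div_le_div_of_nonneg_right key hn0.le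
    _ = ε / 2 + Real.log 4 / n := by field_simp
    _ < ε := by linarith
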